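/- A weakly mixing isometric representation has no nonzero finite-dimensional subrepresentation: let Γ be a group, E a complex Banach space, and π a homomorphism from Γ to the group of linear isometric bijections of E. Assume π is weakly mixing: for every finite set S ⊆ E, every finite set T of continuous linear functionals on E, and every ε > 0, there exists t ∈ Γ such that |φ(π(t)ξ)| < ε for all ξ ∈ S and φ ∈ T. Then every finite-dimensional linear subspace V ⊆ E which is π-invariant (π(t)v ∈ V for all t ∈ Γ and v ∈ V) is the zero subspace. -/

import Mathlib

/-- On a finite-dimensional subspace, the norm is controlled by finitely many continuous linear
functionals on the ambient space. -/
theorem Submodule.exists_finset_dual_norm_le {E : Type*} [NormedAddCommGroup E] [NormedSpace ℂ E]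
    (V : Submodule ℂ E) [FiniteDimensional ℂ V] :
    ∃ (T : Finset (E →L[ℂ] ℂ)) (C : ℝ), 0 < C ∧
      ∀ δ : ℝ, 0 ≤ δ → ∀ w ∈ V, (∀ φ ∈ T, ‖φ w‖ ≤ δ) → ‖w‖ ≤ δ * C := by
  classical
  let b := Module.finBasis ℂ V
  choose φ hφ _ using fun i ↦ exists_extension_norm_eq V (b.coord i).toContinuousLinearMap
  refine ⟨Finset.univ.image φ, 1 + ∑ i, ‖b i‖, by positivity, fun δ hδ w hw hT ↦ ?_⟩
  have hcoord (i) : ‖b.repr ⟨w, hw⟩ i‖ ≤ δ := by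
    have h := hT (φ i) (Finset.mem_image_of_mem φ (Finset.mem_univ i))
    rwa [show φ i w = b.repr ⟨w, hw⟩ i from hφ i ⟨w, hw⟩] at h
  calc ‖w‖ = ‖(⟨w, hw⟩ : V)‖ := rfl
    _ = ‖∑ i, b.repr ⟨w, hw⟩ i • b i‖ := by rw [b.sum_repr]
    _ ≤ ∑ i, δ * ‖b i‖ := norm_sum_le_of_le _ fun i _ ↦ by
        rw [norm_smul]
        exact mul_le_mul_of_nonneg_right (hcoord i) (norm_nonneg _)
    _ = δ * ∑ i, ‖b i‖ := (Finset.mul_sum ..).symm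
    _ ≤ δ * (1 + ∑ i, ‖b i‖) := by gcongr; linarith

/-- A weakly mixing isometric representation of a group on a complex Banach
space has no nonzero finite-dimensional invariant subspace. -/
theorem weakMixing_no_finiteDimensional_subrep
    {Γ : Type*} [Group Γ]
    {E : Type*} [NormedAddCommGroup E] [NormedSpace ℂ E] [CompleteSpace E]
    (π : Γ →* (E ≃ₗᵢ[ℂ] E))
    (hwm : ∀ (S : Finset E) (T : Finset (E →L[ℂ] ℂ)) (ε : ℝ), 0 < ε →
      ∃ t : Γ, ∀ ξ ∈ S, ∀ φ ∈ T, ‖φ (π t ξ)‖ < ε)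
    (V : Submodule ℂ E) (hfd : FiniteDimensional ℂ V)
    (hinv : ∀ t : Γ, ∀ v ∈ V, π t v ∈ V) :
    V = ⊥ := by
  obtain ⟨T, C, hC, hT⟩ := V.exists_finset_dual_norm_le
  refine (Submodule.eq_bot_iff V).2 fun v hv ↦ ?_
  by_contra hv0
  have hpos : 0 < ‖v‖ := norm_pos_iff.2 hv0
  have hδ : 0 < ‖v‖ / (2 * C) := by positivity
  obtain ⟨t, ht⟩ := hwm {v} T _ hδ
  have h := hT _ hδ.le (π t v) (hinv t v hv)
    fun φ hφ ↦ (ht v (Finset.mem_singleton_self v) φ hφ).le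
  rw [LinearIsometryEquiv.norm_map, show ‖v‖ / (2 * C) * C = ‖v‖ / 2 by field_simp] at h
  linarith
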